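/- arXiv:1405.3216 — 2 statements merged into one kernel-verified Lean document; each statement's English description precedes it below -/
import Mathlib

section
/- Let x ∈ W_n satisfy B_n^x = k and let M_{ad x} = (ad x)^{p^n−1} − Σ_{i=0}^{n-1} φ_i(x)(ad x)^{p^i−1}. Then the image of M_{ad x} on W_n equals the k-span of x, x^p, ..., x^{p^{n-1}}, which is n-dimensional. -/
open Finset Polynomial

namespace Module.End

variable {K V : Type*} [Field K] [AddCommGroup V] [Module K V] [Module.Finite K V]

theorem finrank_ker_mul_le (S T : Module.End K V) :
    Module.finrank K (LinearMap.ker (S * T)) ≤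
      Module.finrank K (LinearMap.ker S) + Module.finrank K (LinearMap.ker T) := by
  let f : LinearMap.ker (S * T) →ₗ[K] LinearMap.ker S :=
    T.restrict (p := LinearMap.ker (S * T)) (q := LinearMap.ker S) fun v hv => by simpa using hv
  have hf := LinearMap.finrank_range_add_finrank_ker f
  have h1 : Module.finrank K (LinearMap.range f) ≤ Module.finrank K (LinearMap.ker S) :=
    Submodule.finrank_le _
  have h2 : Module.finrank K (LinearMap.ker f) ≤ Module.finrank K (LinearMap.ker T) := by
    let g : LinearMap.ker f →ₗ[K] LinearMap.ker T :=
      ((Submodule.subtype _).comp (Submodule.subtype _)).codRestrict _ fun v =>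
        congrArg Subtype.val (LinearMap.mem_ker.1 v.2)
    refine LinearMap.finrank_le_finrank_of_injective (f := g) fun a b hab => ?_
    exact Subtype.ext (Subtype.ext (congrArg (fun w : LinearMap.ker T => (w : V)) hab))
  omega

theorem finrank_ker_pow_le (T : Module.End K V)
    (hT : Module.finrank K (LinearMap.ker T) ≤ 1) (a : ℕ) :
    Module.finrank K (LinearMap.ker (T ^ a)) ≤ a := by
  induction a with
  | zero => simp [Module.End.one_eq_id, LinearMap.ker_id]
  | succ a ih =>
    rw [pow_succ]
    have := finrank_ker_mul_le (T ^ a) T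
    omega

theorem X_pow_dvd_of_aeval_eq_zero (T : Module.End K V)
    (hT : Module.finrank K (LinearMap.ker T) ≤ 1) {j : ℕ} (hj : (X : K[X]) ^ j ∣ T.charpoly)
    {q : K[X]} (hq : aeval T q = 0) : (X : K[X]) ^ j ∣ q := by
  rcases eq_or_ne q 0 with rfl | hq0
  · exact dvd_zero _
  obtain ⟨g, hqg, hg⟩ := exists_eq_pow_rootMultiplicity_mul_and_not_dvd q hq0 0
  rw [C_0, sub_zero] at hqg hg
  set a := q.rootMultiplicity 0
  have hle : T.maxGenEigenspace 0 ≤ LinearMap.ker (T ^ a) := by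
    intro v hv
    obtain ⟨N, hN⟩ := (Module.End.mem_maxGenEigenspace T 0 v).1 hv
    rw [zero_smul, sub_zero] at hN
    obtain ⟨u, w, huw⟩ : IsCoprime g ((X : K[X]) ^ N) :=
      (((irreducible_X (R := K)).coprime_iff_not_dvd).2 hg).symm.pow_right
    have h : (X : K[X]) ^ a = u * q + X ^ a * w * X ^ N := by
      calc (X : K[X]) ^ a = X ^ a * (u * g + w * X ^ N) := by rw [huw, mul_one]
        _ = _ := by rw [hqg]; ring
    have h' := congrArg (fun r => aeval T r v) h
    simpa [hq, hN] using h'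
  have h1 : j ≤ T.charpoly.rootMultiplicity 0 :=
    (le_rootMultiplicity_iff T.charpoly_monic.ne_zero).2 (by simpa using hj)
  rw [← LinearMap.finrank_maxGenEigenspace_eq] at h1
  have h2 := (h1.trans (Submodule.finrank_mono hle)).trans (finrank_ker_pow_le T hT a)
  rw [hqg]
  exact (pow_dvd_pow _ h2).mul_right _

theorem aeval_ne_zero_of_X_mul_eq_charpoly (T : Module.End K V)
    (hT : Module.finrank K (LinearMap.ker T) ≤ 1) {r : K[X]} (hr : X * r = T.charpoly) :
    aeval T r ≠ 0 := by
  intro h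
  have hc := T.charpoly_monic.ne_zero
  have hdvd : (X : K[X]) ^ T.charpoly.rootMultiplicity 0 ∣ T.charpoly := by
    simpa using pow_rootMultiplicity_dvd T.charpoly 0
  have h1 := X_pow_dvd_of_aeval_eq_zero T hT hdvd h
  have h2 : T.charpoly.rootMultiplicity 0 + 1 ≤ T.charpoly.rootMultiplicity 0 := by
    rw [le_rootMultiplicity_iff hc, C_0, sub_zero, pow_succ']
    conv_rhs => rw [← hr]
    exact mul_dvd_mul_left _ h1
  omega

end Module.End

namespace Polynomial

theorem Separable.dvd_of_forall_isRoot {K : Type*} [Field K] [IsAlgClosed K] {P q : K[X]} (hP : P.Separable)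
    (h : ∀ a, P.IsRoot a → q.IsRoot a) : P ∣ q := by
  rcases eq_or_ne q 0 with rfl | hq
  · exact dvd_zero _
  have hs := IsAlgClosed.splits P
  have hle : P.roots ≤ q.roots := by
    rw [Multiset.le_iff_subset (nodup_roots hP)]
    intro a ha
    exact (mem_roots hq).2 (h a (isRoot_of_mem_roots ha))
  exact hs.dvd_of_roots_le_roots hP.ne_zero hle

theorem separable_sum_C_mul_X_pow_prime_pow {K : Type*} [Field K] {p : ℕ} [CharP K p]
    (a : ℕ → K) (ha : a 0 ≠ 0) (m : ℕ) :
    (∑ i ∈ range (m + 1), C (a i) * X ^ p ^ i : K[X]).Separable := by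
  have hd : derivative (∑ i ∈ range (m + 1), C (a i) * X ^ p ^ i : K[X]) = C (a 0) := by
    rw [sum_range_succ', derivative_add, derivative_sum, Finset.sum_eq_zero]
    · simp
    · intro i _
      simp [derivative_X_pow]
  rw [separable_def, hd]
  exact isCoprime_one_right.of_isCoprime_of_dvd_right
    ((isUnit_C.2 (isUnit_iff_ne_zero.2 ha)).dvd)

theorem coeff_sum_C_mul_X_pow_prime_pow {K : Type*} [Field K] {p : ℕ} [Fact p.Prime] (c : ℕ → K) {l n : ℕ} (hl : l < n) :
    (∑ i ∈ range n, C (c i) * X ^ p ^ i : K[X]).coeff (p ^ l) = c l := by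
  have hp := (Fact.out : p.Prime)
  rw [finsetSum_coeff, Finset.sum_eq_single l]
  · simp
  · intro i _ hil
    rw [coeff_C_mul, coeff_X_pow, if_neg, mul_zero]
    exact fun h => hil (Nat.pow_right_injective hp.two_le h).symm
  · simp [hl]

variable {K : Type*} [Field K] [IsAlgClosed K] {p : ℕ} [Fact p.Prime] [CharP K p]

/-- A `p`-polynomial that vanishes on the zeros of a monic `p`-polynomial of larger degree, and is
divisible by at least the same power of `X`, is zero. -/
theorem coeff_eq_zero_of_isRoot_of_X_pow_dvd (n : ℕ) (a c : ℕ → K) (han : a n ≠ 0)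
    (hroot : ∀ μ, (∑ i ∈ range (n + 1), C (a i) * X ^ p ^ i : K[X]).IsRoot μ →
      (∑ i ∈ range n, C (c i) * X ^ p ^ i : K[X]).IsRoot μ)
    (hdvd : ∀ j, (X : K[X]) ^ j ∣ ∑ i ∈ range (n + 1), C (a i) * X ^ p ^ i →
      (X : K[X]) ^ j ∣ ∑ i ∈ range n, C (c i) * X ^ p ^ i) :
    ∀ l < n, c l = 0 := by
  classical
  have hp := (Fact.out : p.Prime)
  have hex : ∃ r, a r ≠ 0 := ⟨n, han⟩
  obtain ⟨r, har, hmin⟩ : ∃ r, a r ≠ 0 ∧ ∀ i < r, a i = 0 :=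
    ⟨Nat.find hex, Nat.find_spec hex, fun i hi => by simpa using Nat.find_min hex hi⟩
  have hrn : r ≤ n := by
    by_contra h
    exact han (hmin n (by omega))
  obtain ⟨m, rfl⟩ := Nat.exists_eq_add_of_le hrn
  set Q : K[X] := ∑ i ∈ range (m + 1), C (a (r + i)) * X ^ p ^ i with hQ
  set R : K[X] := ∑ i ∈ range m, C (c (r + i)) * X ^ p ^ i with hR
  have hPQ : (∑ i ∈ range (r + m + 1), C (a i) * X ^ p ^ i : K[X]) = expand K (p ^ r) Q := by
    rw [add_assoc, sum_range_add, Finset.sum_eq_zero, zero_add, hQ, map_sum]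
    · exact Finset.sum_congr rfl fun i _ => by simp [pow_add, pow_mul]
    · intro i hi
      simp [hmin i (Finset.mem_range.1 hi)]
  have hXP : (X : K[X]) ^ p ^ r ∣ ∑ i ∈ range (r + m + 1), C (a i) * X ^ p ^ i := by
    rw [hPQ, hQ, map_sum]
    refine Finset.dvd_sum fun i _ => ?_
    simp only [map_mul, expand_C, map_pow, expand_X]
    exact (dvd_pow_self _ (pow_pos hp.pos i).ne').mul_left _
  have hlow : ∀ l < r, c l = 0 := by
    intro l hl
    rw [← coeff_sum_C_mul_X_pow_prime_pow (p := p) c (show l < r + m by omega)]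
    exact X_pow_dvd_iff.1 (hdvd _ hXP) _ (Nat.pow_lt_pow_right hp.one_lt hl)
  have hqR : (∑ i ∈ range (r + m), C (c i) * X ^ p ^ i : K[X]) = expand K (p ^ r) R := by
    rw [sum_range_add, Finset.sum_eq_zero, zero_add, hR, map_sum]
    · exact Finset.sum_congr rfl fun i _ => by simp [pow_add, pow_mul]
    · intro i hi
      simp [hlow i (Finset.mem_range.1 hi)]
  have hdvdQR : Q ∣ R := by
    refine (separable_sum_C_mul_X_pow_prime_pow (p := p) (fun i => a (r + i)) har
      m).dvd_of_forall_isRoot fun μ hμ => ?_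
    obtain ⟨ν, hν⟩ := IsAlgClosed.exists_pow_nat_eq μ (pow_pos hp.pos r)
    have := hroot ν (by rw [hPQ, IsRoot, expand_eval, hν]; exact hμ)
    rwa [hqR, IsRoot, expand_eval, hν] at this
  have hR0 : R = 0 := by
    by_contra hne
    have hdeg := natDegree_le_of_dvd hdvdQR hne
    have hRdeg : R.natDegree < p ^ m := by
      rcases m with _ | m
      · simp [hR] at hne
      · refine lt_of_le_of_lt (natDegree_sum_le_of_forall_le _ _ (n := p ^ m) fun i hi => ?_)
          (Nat.pow_lt_pow_right hp.one_lt (Nat.lt_succ_self m))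
        exact (natDegree_C_mul_X_pow_le _ _).trans
          (Nat.pow_le_pow_right hp.pos (by have := Finset.mem_range.1 hi; omega))
    have hQdeg : p ^ m ≤ Q.natDegree := by
      refine le_natDegree_of_ne_zero ?_
      rw [coeff_sum_C_mul_X_pow_prime_pow (p := p) (fun i => a (r + i)) (Nat.lt_succ_self m)]
      exact han
    omega
  intro l hl
  rcases lt_or_ge l r with h | h
  · exact hlow l h
  obtain ⟨i, rfl⟩ := Nat.exists_eq_add_of_le h
  rw [← coeff_sum_C_mul_X_pow_prime_pow (p := p) (fun i => c (r + i)) (show i < m by omega), ← hR,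
    hR0, coeff_zero]

end Polynomial

section PolynomialFamilies

variable (K V : Type*) [Field K] [AddCommGroup V] [Module K V]

/-- The functions of the form `s ↦ ∑ m, s ^ m • v m`. -/
def polynomialFamilies : Submodule K (K → V) :=
  Submodule.span K (Set.range fun a : ℕ × V => fun s => s ^ a.1 • a.2)

variable {K V} {U W : Type*} [AddCommGroup U] [Module K U] [AddCommGroup W] [Module K W]

theorem const_mem_polynomialFamilies (v : V) : (fun _ => v) ∈ polynomialFamilies K V :=
  Submodule.subset_span ⟨(0, v), by simp⟩

theorem smul_const_mem_polynomialFamilies (v : V) : (fun s => s • v) ∈ polynomialFamilies K V :=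
  Submodule.subset_span ⟨(1, v), by simp⟩

theorem map₂_mem_polynomialFamilies (b : U →ₗ[K] V →ₗ[K] W) {F : K → U} {G : K → V}
    (hF : F ∈ polynomialFamilies K U) (hG : G ∈ polynomialFamilies K V) :
    (fun s => b (F s) (G s)) ∈ polynomialFamilies K W := by
  induction hF, hG using Submodule.span_induction₂ with
  | mem_mem F G hF hG =>
    obtain ⟨⟨i, u⟩, rfl⟩ := hF
    obtain ⟨⟨j, v⟩, rfl⟩ := hG
    exact Submodule.subset_span ⟨(i + j, b u v), by
      funext s
      rw [map_smul, map_smul, LinearMap.smul_apply, smul_smul, ← pow_add, add_comm]⟩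
  | zero_left G _ => simpa using const_mem_polynomialFamilies (0 : W)
  | zero_right F _ => simpa using const_mem_polynomialFamilies (0 : W)
  | add_left F F' G _ _ _ h h' => simpa [Pi.add_def] using Submodule.add_mem _ h h'
  | add_right F G G' _ _ _ h h' => simpa [Pi.add_def] using Submodule.add_mem _ h h'
  | smul_left c F G _ _ h => simpa [Pi.smul_def] using Submodule.smul_mem _ c h
  | smul_right c F G _ _ h => simpa [Pi.smul_def] using Submodule.smul_mem _ c h

theorem map_mem_polynomialFamilies (f : V →ₗ[K] W) {F : K → V}
    (hF : F ∈ polynomialFamilies K V) : (fun s => f (F s)) ∈ polynomialFamilies K W :=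
  map₂_mem_polynomialFamilies ((LinearMap.id : (V →ₗ[K] W) →ₗ[K] _))
    (const_mem_polynomialFamilies f) hF

theorem eval_mem_polynomialFamilies (q : K[X]) : (fun s => q.eval s) ∈ polynomialFamilies K K := by
  have : (fun s => q.eval s) = ∑ i ∈ range (q.natDegree + 1), fun s => s ^ i • q.coeff i := by
    funext s
    rw [eval_eq_sum_range, Finset.sum_apply]
    exact Finset.sum_congr rfl fun i _ => by rw [smul_eq_mul, mul_comm]
  rw [this]
  exact Submodule.sum_mem _ fun i _ => Submodule.subset_span ⟨(i, q.coeff i), rfl⟩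

theorem exists_eval_eq_of_mem_polynomialFamilies {F : K → K} (hF : F ∈ polynomialFamilies K K) :
    ∃ q : K[X], ∀ s, F s = q.eval s := by
  induction hF using Submodule.span_induction with
  | mem F hF =>
    obtain ⟨⟨i, u⟩, rfl⟩ := hF
    exact ⟨C u * X ^ i, fun s => by
      rw [eval_mul, eval_C, eval_pow, eval_X]
      exact mul_comm _ _⟩
  | zero => exact ⟨0, by simp⟩
  | add F G _ _ hF hG =>
    obtain ⟨q, hq⟩ := hF
    obtain ⟨r, hr⟩ := hG
    exact ⟨q + r, fun s => by simp [hq, hr]⟩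
  | smul c F _ hF =>
    obtain ⟨q, hq⟩ := hF
    exact ⟨C c * q, fun s => by simp [hq]⟩

variable {ι : Type*} [Fintype ι] [DecidableEq ι]

theorem finite_setOf_det_eq_zero {A : K → Matrix ι ι K}
    (hA : ∀ i j, (fun s => A s i j) ∈ polynomialFamilies K K) {s₀ : K} (h₀ : (A s₀).det ≠ 0) :
    {s | (A s).det = 0}.Finite := by
  choose q hq using fun i j => exists_eval_eq_of_mem_polynomialFamilies (hA i j)
  have hdet : ∀ s, (A s).det = (Matrix.of q).det.eval s := by
    intro s
    rw [← coe_evalRingHom, RingHom.map_det]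
    congr 1
    ext i j
    simp [hq]
  have hne : (Matrix.of q).det ≠ 0 := by
    intro h
    exact h₀ (by rw [hdet, h, eval_zero])
  simp_rw [hdet]
  exact Polynomial.finite_setOfPred_isRoot hne

theorem finite_setOf_not_linearIndependent {F : ι → K → V}
    (hF : ∀ i, F i ∈ polynomialFamilies K V) {s₀ : K}
    (h₀ : LinearIndependent K fun i => F i s₀) :
    {s | ¬ LinearIndependent K fun i => F i s}.Finite := by
  obtain ⟨g, hg⟩ := (Fintype.linearCombination K fun i => F i s₀).exists_leftInverse_of_injective
    (LinearMap.ker_eq_bot.2 h₀.fintypeLinearCombination_injective)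
  have hg' : ∀ i, g (F i s₀) = Pi.single i 1 := by
    intro i
    have := LinearMap.congr_fun hg (Pi.single i 1)
    simpa using this
  refine (finite_setOf_det_eq_zero (A := fun s => Matrix.of fun i => g (F i s)) (s₀ := s₀)
    (fun i j => ?_) ?_).subset fun s hs => ?_
  · exact map_mem_polynomialFamilies ((LinearMap.proj j).comp g) (hF i)
  · have : (Matrix.of fun i => g (F i s₀)) = (1 : Matrix ι ι K) := by
      ext i j
      simp [hg', Matrix.one_apply, Pi.single_apply, eq_comm]
    simp [this]
  · by_contra hdet
    refine hs (LinearIndependent.of_comp g ?_)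
    exact Matrix.linearIndependent_rows_of_det_ne_zero hdet

theorem finite_setOf_finrank_range_lt [Module.Finite K W] {T : K → V →ₗ[K] W}
    (hT : ∀ v, (fun s => T s v) ∈ polynomialFamilies K W) (s₀ : K) :
    {s | Module.finrank K (LinearMap.range (T s)) <
      Module.finrank K (LinearMap.range (T s₀))}.Finite := by
  let b := Module.finBasis K (LinearMap.range (T s₀))
  choose v hv using fun i => (b i).2
  have hli : LinearIndependent K fun i => T s₀ (v i) := by
    simp_rw [hv]
    exact b.linearIndependent.map' _ (Submodule.ker_subtype _)
  refine (finite_setOf_not_linearIndependent (F := fun i s => T s (v i)) (fun i => hT (v i))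
    hli).subset fun s hs hind => ?_
  have hind' : LinearIndependent K fun i => (⟨T s (v i), v i, rfl⟩ : LinearMap.range (T s)) :=
    LinearIndependent.of_comp (Submodule.subtype _) hind
  have := hind'.fintype_card_le_finrank
  simp only [Fintype.card_fin] at this
  exact absurd hs (not_lt.2 this)

theorem coeff_charpoly_mem_polynomialFamilies [Module.Finite K V] (S T : Module.End K V) (m : ℕ) :
    (fun s : K => (S + s • T).charpoly.coeff m) ∈ polynomialFamilies K K := by
  let b := Module.finBasis K V
  let N : Matrix (Fin (Module.finrank K V)) (Fin (Module.finrank K V)) K[X] :=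
    (LinearMap.toMatrix b b S).map C + (X : K[X]) • (LinearMap.toMatrix b b T).map C
  convert eval_mem_polynomialFamilies (N.charpoly.coeff m) using 2 with s
  rw [← LinearMap.charpoly_toMatrix _ b, ← coe_evalRingHom, ← coeff_map, ← Matrix.charpoly_map]
  congr 2
  ext i j
  simp [N]
  ring

end PolynomialFamilies

theorem exists_det_pow_prime_pow_ne_zero (K : Type*) [Field K] [Infinite K] (p n : ℕ)
    (hp : 1 < p) :
    ∃ c : Fin n → K, (Matrix.of fun l i : Fin n => c i ^ p ^ (l : ℕ)).det ≠ 0 := by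
  let v : Fin n → K[X] := fun l => X ^ p ^ (l : ℕ)
  have hv : Function.Injective v := fun l m h => by
    have := congrArg natDegree h
    simp only [v, natDegree_X_pow] at this
    exact Fin.ext (Nat.pow_right_injective hp this)
  have hdet := Matrix.det_vandermonde_ne_zero_iff.2 hv
  obtain ⟨t, ht⟩ : ∃ t, (Matrix.vandermonde v).det.eval t ≠ 0 := by
    by_contra! h
    exact hdet (Polynomial.funext fun t => by rw [h t, eval_zero])
  refine ⟨fun i => t ^ (i : ℕ), ?_⟩
  rw [← coe_evalRingHom, RingHom.map_det] at ht
  convert ht using 2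
  ext l i
  simp [Matrix.vandermonde_apply, v, ← pow_mul, mul_comm]

namespace Derivation

section Ring

variable {K B : Type*} [CommRing K] [CommRing B] [Algebra K B]

theorem iterate_lie_smul_of_lie_eq_zero (x z : Derivation K B B) (hz : ⁅x, z⁆ = 0) (f : B)
    (m : ℕ) : (fun w => ⁅x, w⁆)^[m] (f • z) = ((x : B →ₗ[K] B) ^ m) f • z := by
  induction m with
  | zero => simp
  | succ m ih =>
    rw [Function.iterate_succ_apply', ih, pow_succ', Module.End.mul_apply]
    ext a
    have ha : x (z a) = z (x a) := by
      have := congrArg (fun w : Derivation K B B => w a) hz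
      simpa [Derivation.commutator_apply, sub_eq_zero] using this
    simp only [Derivation.commutator_apply, Derivation.smul_apply, smul_eq_mul,
      Derivation.leibniz, ha, Derivation.coeFn_coe]
    ring

theorem exists_coe_eq_pow_char_pow (p : ℕ) [Fact p.Prime] [CharP K p]
    (x : Derivation K B B) (i : ℕ) :
    ∃ z : Derivation K B B, (z : B →ₗ[K] B) = (x : B →ₗ[K] B) ^ p ^ i := by
  let A := Module.End K B
  let d : A := (x : B →ₗ[K] B)
  have hchar : (p : Module.End K A) = 0 := LinearMap.ext fun f => by
    rw [Module.End.natCast_apply, ← Nat.cast_smul_eq_nsmul K, CharP.cast_eq_zero, zero_smul,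
      LinearMap.zero_apply]
  have hsub : (LinearMap.mulLeft K d - LinearMap.mulRight K d) ^ p ^ i =
      LinearMap.mulLeft K (d ^ p ^ i) - LinearMap.mulRight K (d ^ p ^ i) := by
    rw [← LinearMap.pow_mulLeft, ← LinearMap.pow_mulRight]
    rcases subsingleton_or_nontrivial (Module.End K A) with h | h
    · exact Subsingleton.elim _ _
    · have : CharP (Module.End K A) p := (CharP.charP_iff_prime_eq_zero Fact.out).2 hchar
      exact sub_pow_char_pow_of_commute (R := Module.End K A) (p := p) i
        (LinearMap.commute_mulLeft_right (R := K) d d)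
  have hiter : ∀ m (f : B), ((LinearMap.mulLeft K d - LinearMap.mulRight K d) ^ m)
      (LinearMap.mulLeft K f) = LinearMap.mulLeft K ((d ^ m) f) := by
    intro m f
    induction m with
    | zero => rfl
    | succ m ih =>
      rw [pow_succ', Module.End.mul_apply, ih, pow_succ' d, Module.End.mul_apply]
      ext a
      change x ((d ^ m) f * a) - (d ^ m) f * x a = x ((d ^ m) f) * a
      rw [Derivation.leibniz, smul_eq_mul, smul_eq_mul]
      ring
  refine ⟨Derivation.mk' (d ^ p ^ i) fun a b => ?_, rfl⟩
  have h := LinearMap.congr_fun (hiter (p ^ i) a) b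
  rw [hsub] at h
  change (d ^ p ^ i) (a * b) - a * (d ^ p ^ i) b = (d ^ p ^ i) a * b at h
  rw [smul_eq_mul, smul_eq_mul, mul_comm b, ← h]
  ring

theorem exists_sum_smul_eq_of_isUnit_det {n : ℕ} (u : Fin n → B)
    (hu : Algebra.adjoin K (Set.range u) = ⊤) (z : Fin n → Derivation K B B)
    (hz : IsUnit (Matrix.of fun l i => z l (u i)).det) (w : Derivation K B B) :
    ∃ b : Fin n → B, w = ∑ l, b l • z l := by
  let Z : Matrix (Fin n) (Fin n) B := Matrix.of fun l i => z l (u i)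
  refine ⟨Matrix.vecMul (fun i => w (u i)) Z⁻¹, ?_⟩
  refine Derivation.ext_of_adjoin_eq_top _ hu ?_
  rintro _ ⟨i, rfl⟩
  have h : Matrix.vecMul (Matrix.vecMul (fun i => w (u i)) Z⁻¹) Z = fun i => w (u i) := by
    rw [Matrix.vecMul_vecMul, Matrix.nonsing_inv_mul _ hz, Matrix.vecMul_one]
  have hi := congrFun h i
  rw [← hi, Matrix.vecMul, dotProduct]
  have hsum : ∀ b : Fin n → B, (∑ l, b l • z l) (u i) = ∑ l, b l * z l (u i) := by
    intro b
    rw [← Derivation.coeFnAddMonoidHom_apply, map_sum, Finset.sum_apply]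
    rfl
  rw [hsum]
  rfl

end Ring

end Derivation

section TruncatedPolynomial

variable (K : Type*) [Field K] (p n : ℕ)

/-- The ideal `(x₁ ^ p, …, xₙ ^ p)` of `K[x₁, …, xₙ]`. -/
noncomputable abbrev truncationIdeal : Ideal (MvPolynomial (Fin n) K) :=
  Ideal.span (Set.range fun i : Fin n => (MvPolynomial.X i : MvPolynomial (Fin n) K) ^ p)

variable {K p n} {B : Type*} [CommRing B] [Algebra K B]

theorem adjoin_range_eq_top_of_algEquiv (e : (MvPolynomial (Fin n) K ⧸ truncationIdeal K p n) ≃ₐ[K] B) :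
    Algebra.adjoin K (Set.range fun i => e (Ideal.Quotient.mk _ (MvPolynomial.X i))) = ⊤ := by
  let g : MvPolynomial (Fin n) K →ₐ[K] B := (e : (MvPolynomial (Fin n) K ⧸ truncationIdeal K p n) →ₐ[K] B).comp
      (Ideal.Quotient.mkₐ K _)
  have hg : Function.Surjective g :=
    e.surjective.comp (Ideal.Quotient.mkₐ_surjective K _)
  have h := AlgHom.map_adjoin g (Set.range (MvPolynomial.X : Fin n → MvPolynomial (Fin n) K))
  rw [MvPolynomial.adjoin_range_X, Algebra.map_top, (AlgHom.range_eq_top g).2 hg,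
    ← Set.range_comp] at h
  exact h.symm

theorem exists_algHom_apply_eq_zero (hp : p ≠ 0) (e : (MvPolynomial (Fin n) K ⧸ truncationIdeal K p n) ≃ₐ[K] B) :
    ∃ ε : B →ₐ[K] K, ∀ i, ε (e (Ideal.Quotient.mk _ (MvPolynomial.X i))) = 0 := by
  let ε : (MvPolynomial (Fin n) K ⧸ truncationIdeal K p n) →ₐ[K] K :=
    Ideal.Quotient.liftₐ _ (MvPolynomial.aeval fun _ => 0) fun a ha => by
      have hle : truncationIdeal K p n ≤
          RingHom.ker (MvPolynomial.aeval (R := K) fun _ : Fin n => (0 : K)) := by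
        rw [Ideal.span_le]
        rintro _ ⟨i, rfl⟩
        simp [RingHom.mem_ker, hp]
      exact hle ha
  refine ⟨ε.comp e.symm, fun i => ?_⟩
  change ε (e.symm (e (Ideal.Quotient.mk _ (MvPolynomial.X i)))) = 0
  rw [e.symm_apply_apply]
  exact MvPolynomial.aeval_X _ i

theorem isUnit_of_algHom_apply_ne_zero [Fact p.Prime] [CharP K p]
    (e : (MvPolynomial (Fin n) K ⧸ truncationIdeal K p n) ≃ₐ[K] B) (ε : B →ₐ[K] K)
    (hε : ∀ i, ε (e (Ideal.Quotient.mk _ (MvPolynomial.X i))) = 0) {b : B} (hb : ε b ≠ 0) :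
    IsUnit b := by
  have hp := (Fact.out : p.Prime)
  have : Nontrivial B := ε.toRingHom.domain_nontrivial
  have : CharP B p := charP_of_injective_algebraMap (algebraMap K B).injective p
  have hpow : ∀ b : B, b ^ p = algebraMap K B (ε b ^ p) := by
    intro b
    obtain ⟨q, rfl⟩ := e.surjective b
    obtain ⟨q, rfl⟩ := Ideal.Quotient.mk_surjective q
    let g : MvPolynomial (Fin n) K →+* B :=
      (e : (MvPolynomial (Fin n) K ⧸ truncationIdeal K p n) →+* B).comp (Ideal.Quotient.mk _)
    have hX : ∀ i, g (MvPolynomial.X i) ^ p = 0 := by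
      intro i
      rw [← map_pow]
      change e (Ideal.Quotient.mk _ (MvPolynomial.X i ^ p)) = 0
      have hmem : MvPolynomial.X i ^ p ∈ truncationIdeal K p n := Ideal.subset_span ⟨i, rfl⟩
      rw [Ideal.Quotient.eq_zero_iff_mem.2 hmem, map_zero]
    have hC : ∀ c, g (MvPolynomial.C c) = algebraMap K B c := fun c =>
      e.commutes c
    have hgε : (frobenius B p).comp g =
        ((algebraMap K B).comp (frobenius K p)).comp ((ε : B →+* K).comp g) := by
      refine MvPolynomial.ringHom_ext (fun c => ?_) fun i => ?_
      · simp [hC, frobenius_def]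
      · have hi : ε (g (MvPolynomial.X i)) = 0 := hε i
        simp [hi, frobenius_def, hX, hp.ne_zero]
    exact RingHom.congr_fun hgε q
  refine (isUnit_pow_iff hp.ne_zero).1 ?_
  rw [hpow]
  exact (isUnit_iff_ne_zero.2 (pow_ne_zero p hb)).map (algebraMap K B)

theorem exists_derivation_apply_eq [CharP K p] (e : (MvPolynomial (Fin n) K ⧸ truncationIdeal K p n) ≃ₐ[K] B)
    (b : Fin n → B) :
    ∃ y : Derivation K B B, ∀ i, y (e (Ideal.Quotient.mk _ (MvPolynomial.X i))) = b i := by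
  let g : MvPolynomial (Fin n) K →ₐ[K] B := (e : (MvPolynomial (Fin n) K ⧸ truncationIdeal K p n) →ₐ[K] B).comp
      (Ideal.Quotient.mkₐ K _)
  have hg : Function.Surjective g :=
    e.surjective.comp (Ideal.Quotient.mkₐ_surjective K _)
  choose a ha using fun i => hg (b i)
  let D : Derivation K (MvPolynomial (Fin n) K) (MvPolynomial (Fin n) K) :=
    MvPolynomial.mkDerivation K a
  have hker : ∀ f, g f = 0 → g (D f) = 0 := by
    intro f hf
    have hf' : f ∈ truncationIdeal K p n := by
      rw [← Ideal.Quotient.eq_zero_iff_mem]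
      exact e.injective (hf.trans (map_zero e).symm)
    induction hf' using Submodule.span_induction with
    | mem f hf' =>
      obtain ⟨i, rfl⟩ := hf'
      simp [Derivation.leibniz_pow, nsmul_eq_mul]
    | zero => simp
    | add f f' h h' ih ih' =>
      have hz : ∀ f ∈ truncationIdeal K p n, g f = 0 := fun f h => by
        change e (Ideal.Quotient.mk _ f) = 0
        rw [Ideal.Quotient.eq_zero_iff_mem.2 h, map_zero]
      rw [map_add, map_add, ih (hz _ h), ih' (hz _ h'), add_zero]
    | smul c f h ih =>
      have hz : g f = 0 := by
        change e (Ideal.Quotient.mk _ f) = 0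
        rw [Ideal.Quotient.eq_zero_iff_mem.2 h, map_zero]
      rw [smul_eq_mul, Derivation.leibniz, map_add, smul_eq_mul, smul_eq_mul, map_mul, map_mul,
        ih hz, hz, mul_zero, zero_mul, add_zero]
  refine ⟨Derivation.liftOfSurjective (d := D) hg hker, fun i => ?_⟩
  have := Derivation.liftOfSurjective_apply (d := D) hg hker (MvPolynomial.X i)
  rw [MvPolynomial.mkDerivation_X, ha] at this
  exact this

end TruncatedPolynomial

namespace Derivation

variable {K B : Type*} [Field K] [CommRing B] [Algebra K B]

theorem aeval_ad_smul_of_lie_eq_zero (x z : Derivation K B B) (hz : ⁅x, z⁆ = 0) (r : K[X])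
    (f : B) : aeval (LieAlgebra.ad K (Derivation K B B) x) r (f • z) =
      (aeval (x : B →ₗ[K] B) r f) • z := by
  induction r using Polynomial.induction_on' with
  | add r s hr hs => simp only [map_add, LinearMap.add_apply, hr, hs, add_smul]
  | monomial m a =>
    rw [aeval_monomial, aeval_monomial, Module.End.mul_apply, Module.End.mul_apply,
      Module.algebraMap_end_apply, Module.algebraMap_end_apply, Module.End.pow_apply, smul_assoc]
    congr 1
    exact iterate_lie_smul_of_lie_eq_zero x z hz f m

theorem range_aeval_ad_le_span (x : Derivation K B B)
    (hx : ∀ f, x f = 0 → ∃ c : K, f = algebraMap K B c) {n : ℕ}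
    (z : Fin n → Derivation K B B) (hz : ∀ l, ⁅x, z l⁆ = 0)
    (hspan : ∀ w : Derivation K B B, ∃ b : Fin n → B, w = ∑ l, b l • z l) {r : K[X]}
    (hr : aeval (x : B →ₗ[K] B) (X * r) = 0) :
    LinearMap.range (aeval (LieAlgebra.ad K (Derivation K B B) x) r) ≤
      Submodule.span K (Set.range z) := by
  rintro _ ⟨w, rfl⟩
  obtain ⟨b, rfl⟩ := hspan w
  rw [map_sum]
  refine Submodule.sum_mem _ fun l _ => ?_
  rw [aeval_ad_smul_of_lie_eq_zero x _ (hz l)]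
  obtain ⟨c, hc⟩ := hx (aeval (x : B →ₗ[K] B) r (b l)) (by
    have := LinearMap.congr_fun hr (b l)
    rwa [map_mul, aeval_X] at this)
  rw [hc, algebraMap_smul]
  exact Submodule.smul_mem _ c (Submodule.subset_span ⟨l, rfl⟩)

theorem lie_eq_zero_of_coe_eq_pow {x z : Derivation K B B} {m : ℕ}
    (hz : (z : B →ₗ[K] B) = (x : B →ₗ[K] B) ^ m) : ⁅x, z⁆ = 0 := by
  ext a
  have hz' : ∀ a, z a = ((x : B →ₗ[K] B) ^ m) a := fun a => LinearMap.congr_fun hz a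
  rw [commutator_apply, hz', hz', Derivation.zero_apply, sub_eq_zero, ← Derivation.coeFn_coe x,
    ← Module.End.mul_apply, ← Module.End.mul_apply, ← pow_succ, ← pow_succ']

variable (K B) in
/-- The inclusion of the derivations of `B` in the linear endomorphisms of `B`. -/
def toEnd : Derivation K B B →ₗ[K] B →ₗ[K] B where
  toFun x := x
  map_add' _ _ := rfl
  map_smul' _ _ := rfl

theorem finite_of_finite [Module.Finite K B] : Module.Finite K (Derivation K B B) :=
  Module.Finite.of_injective (toEnd K B) fun _ _ h =>
    Derivation.ext fun a => LinearMap.congr_fun h a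

theorem pow_apply_mem_polynomialFamilies {F : K → Derivation K B B}
    (hF : F ∈ polynomialFamilies K (Derivation K B B)) (m : ℕ) (b : B) :
    (fun s => ((F s : B →ₗ[K] B) ^ m) b) ∈ polynomialFamilies K B := by
  induction m with
  | zero => exact const_mem_polynomialFamilies b
  | succ m ih =>
    simp_rw [pow_succ', Module.End.mul_apply]
    exact map₂_mem_polynomialFamilies (toEnd K B) hF ih

theorem ad_pow_apply_mem_polynomialFamilies {F : K → Derivation K B B}
    (hF : F ∈ polynomialFamilies K (Derivation K B B)) (m : ℕ) (w : Derivation K B B) :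
    (fun s => (LieAlgebra.ad K (Derivation K B B) (F s) ^ m) w) ∈
      polynomialFamilies K (Derivation K B B) := by
  induction m with
  | zero => exact const_mem_polynomialFamilies w
  | succ m ih =>
    simp_rw [pow_succ', Module.End.mul_apply]
    exact map₂_mem_polynomialFamilies
      (V := Derivation K B B) (W := Derivation K B B)
      (LieAlgebra.ad K (Derivation K B B) : Derivation K B B →ₗ[K] Module.End K _) hF ih

theorem pow_apply_of_apply_eq_smul_one_add (y : Derivation K B B) {u : B} {c : K}
    (hy : y u = c • (1 + u)) (m : ℕ) :
    ((y : B →ₗ[K] B) ^ (m + 1)) u = c ^ (m + 1) • (1 + u) := by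
  induction m with
  | zero => simpa using hy
  | succ m ih =>
    rw [pow_succ', Module.End.mul_apply, ih, Derivation.coeFn_coe, Derivation.map_smul, map_add,
      Derivation.map_one_eq_zero, zero_add, hy, smul_smul, ← pow_succ]

theorem exists_eq_algebraMap_of_finrank_le [Module.Finite K B] [Nontrivial B]
    (x w : Derivation K B B) (hx : ∀ f : B, x f = 0 → ∃ c : K, f = algebraMap K B c)
    (h : Module.finrank K (LinearMap.range (x : B →ₗ[K] B)) ≤
      Module.finrank K (LinearMap.range (w : B →ₗ[K] B))) (f : B) (hf : w f = 0) :
    ∃ c : K, f = algebraMap K B c := by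
  have h1 : LinearMap.ker (x : B →ₗ[K] B) ≤ LinearMap.ker (w : B →ₗ[K] B) := by
    intro g hg
    obtain ⟨c, rfl⟩ := hx g hg
    exact w.map_algebraMap c
  have hle : Module.finrank K (LinearMap.ker (w : B →ₗ[K] B)) ≤
      Module.finrank K (LinearMap.ker (x : B →ₗ[K] B)) := by
    have h2 := LinearMap.finrank_range_add_finrank_ker (x : B →ₗ[K] B)
    have h3 := LinearMap.finrank_range_add_finrank_ker (w : B →ₗ[K] B)
    omega
  have heq := Submodule.eq_of_le_of_finrank_le h1 hle
  refine hx f ?_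
  have : f ∈ LinearMap.ker (w : B →ₗ[K] B) := hf
  rwa [← heq] at this

theorem finrank_ker_le_one (x : Derivation K B B)
    (hx : ∀ f : B, x f = 0 → ∃ c : K, f = algebraMap K B c) :
    Module.finrank K (LinearMap.ker (x : B →ₗ[K] B)) ≤ 1 := by
  have hle : LinearMap.ker (x : B →ₗ[K] B) ≤ Submodule.span K {(1 : B)} := by
    intro f hf
    obtain ⟨c, rfl⟩ := hx f hf
    exact Submodule.mem_span_singleton.2 ⟨c, (Algebra.algebraMap_eq_smul_one c).symm⟩
  exact (Submodule.finrank_mono hle).trans ((finrank_span_le_card {(1 : B)}).trans (by simp))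

theorem linearIndependent_pow_prime_pow [IsAlgClosed K] [Module.Finite K B] {p n : ℕ}
    [Fact p.Prime] [CharP K p] {a : Fin n → K} {x : Derivation K B B}
    (hcharpoly : LinearMap.charpoly (x : B →ₗ[K] B) =
      X ^ p ^ n - ∑ i : Fin n, C (a i) * X ^ p ^ (i : ℕ))
    (hx : ∀ f : B, x f = 0 → ∃ c : K, f = algebraMap K B c) :
    LinearIndependent K fun i : Fin n => (x : B →ₗ[K] B) ^ p ^ (i : ℕ) := by
  rw [Fintype.linearIndependent_iff]
  intro g hg
  let c : ℕ → K := fun i => if h : i < n then g ⟨i, h⟩ else 0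
  let b : ℕ → K := fun i => if h : i < n then -a ⟨i, h⟩ else 1
  have hP : (∑ i ∈ range (n + 1), C (b i) * X ^ p ^ i : K[X]) =
      LinearMap.charpoly (x : B →ₗ[K] B) := by
    rw [sum_range_succ, Finset.sum_range, hcharpoly]
    simp [b, add_comm, sub_eq_add_neg]
  have hq : aeval (x : B →ₗ[K] B) (∑ i ∈ range n, C (c i) * X ^ p ^ i : K[X]) = 0 := by
    rw [Finset.sum_range, map_sum, ← hg]
    refine Finset.sum_congr rfl fun i _ => ?_
    simp [c, Algebra.smul_def]
  have hc := coeff_eq_zero_of_isRoot_of_X_pow_dvd (p := p) n b c (by simp [b])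
    (fun μ hμ => by
      rw [hP, ← Module.End.hasEigenvalue_iff_isRoot_charpoly] at hμ
      obtain ⟨v, hv⟩ := hμ.exists_hasEigenvector
      have h := Module.End.aeval_apply_of_hasEigenvector
        (p := ∑ i ∈ range n, C (c i) * X ^ p ^ i) hv
      rw [hq, LinearMap.zero_apply, eq_comm, smul_eq_zero] at h
      exact h.resolve_right hv.2)
    (fun j hj => Module.End.X_pow_dvd_of_aeval_eq_zero _ (finrank_ker_le_one x hx)
      (hP ▸ hj) hq)
  intro i
  have := hc i i.2
  simpa [c] using this

/-- Semicontinuity along the line from `x` to a derivation `y` whose `p`-power iterates form a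
basis of the module of derivations. -/
theorem finrank_range_aeval_ad_le {k B : Type*} [Field k] [Infinite k] {p n : ℕ} [Fact p.Prime]
    [CharP k p] [CommRing B] [Algebra k B] [Module.Finite k B]
    (e : (MvPolynomial (Fin n) k ⧸ truncationIdeal k p n) ≃ₐ[k] B)
    {r : Derivation k B B → k[X]}
    (hr : ∀ y : Derivation k B B, aeval (y : B →ₗ[k] B) (X * r y) = 0)
    (hpoly : ∀ (x y : Derivation k B B) (w : Derivation k B B),
      (fun s : k => aeval (LieAlgebra.ad k (Derivation k B B) (x + s • y)) (r (x + s • y)) w) ∈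
        polynomialFamilies k (Derivation k B B))
    (x : Derivation k B B) (hx : ∀ f : B, x f = 0 → ∃ c : k, f = algebraMap k B c) :
    Module.finrank k (LinearMap.range
      (aeval (LieAlgebra.ad k (Derivation k B B) x) (r x))) ≤ n := by
  have hp := (Fact.out : p.Prime)
  have := finite_of_finite (K := k) (B := B)
  obtain ⟨ε, hε⟩ := exists_algHom_apply_eq_zero hp.ne_zero e
  have : Nontrivial B := ε.toRingHom.domain_nontrivial
  let u : Fin n → B := fun i => e (Ideal.Quotient.mk _ (MvPolynomial.X i))
  obtain ⟨c, hc⟩ := exists_det_pow_prime_pow_ne_zero k p n hp.one_lt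
  obtain ⟨y, hy⟩ : ∃ y : Derivation k B B, ∀ i, y (u i) = c i • (1 + u i) :=
    exists_derivation_apply_eq e fun i => c i • (1 + u i)
  let F : k → Derivation k B B := fun s => x + s • (y - x)
  have hF : F ∈ polynomialFamilies k (Derivation k B B) :=
    Submodule.add_mem _ (const_mem_polynomialFamilies x) (smul_const_mem_polynomialFamilies _)
  have hF0 : F 0 = x := by simp [F]
  have hF1 : F 1 = y := by simp [F]
  let A : k → Matrix (Fin n) (Fin n) k := fun s =>
    Matrix.of fun l i => ε (((F s : B →ₗ[k] B) ^ p ^ (l : ℕ)) (u i))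
  have hA1 : (A 1).det ≠ 0 := by
    convert hc using 2
    ext l i
    obtain ⟨m, hm⟩ := Nat.exists_eq_succ_of_ne_zero (pow_pos hp.pos (l : ℕ)).ne'
    have hεu : ε (u i) = 0 := hε i
    simp only [A, Matrix.of_apply, hF1]
    rw [hm, Nat.succ_eq_add_one, pow_apply_of_apply_eq_smul_one_add y (hy i), _root_.map_smul ε, map_add,
      hεu, map_one, add_zero, smul_eq_mul, mul_one]
  have hdet := finite_setOf_det_eq_zero (A := A) (s₀ := 1) (fun l i =>
    map_mem_polynomialFamilies ε.toLinearMap (pow_apply_mem_polynomialFamilies hF _ _)) hA1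
  have hker := finite_setOf_finrank_range_lt (T := fun s => (F s : B →ₗ[k] B))
    (fun b => by simpa using pow_apply_mem_polynomialFamilies hF 1 b) 0
  beta_reduce at hker
  rw [hF0] at hker
  have hrange := finite_setOf_finrank_range_lt
    (T := fun s => aeval (LieAlgebra.ad k (Derivation k B B) (F s)) (r (F s)))
    (hpoly x (y - x)) 0
  beta_reduce at hrange
  rw [hF0] at hrange
  obtain ⟨s, hs⟩ := ((hdet.union hker).union hrange).exists_notMem
  simp only [Set.mem_union, Set.mem_ofPred_eq, not_or, not_lt] at hs
  obtain ⟨⟨hsdet, hsker⟩, hsrange⟩ := hs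
  choose z hz using fun l : Fin n => exists_coe_eq_pow_char_pow p (F s) l
  have hunit : IsUnit (Matrix.of fun l i => z l (u i)).det := by
    refine isUnit_of_algHom_apply_ne_zero e ε hε ?_
    rw [AlgHom.map_det]
    convert hsdet using 2
    ext l i
    simp only [A, Matrix.of_apply, ← hz]
    rfl
  have hle := range_aeval_ad_le_span (F s)
    (exists_eq_algebraMap_of_finrank_le x (F s) hx hsker) z
    (fun l => lie_eq_zero_of_coe_eq_pow (hz l))
    (exists_sum_smul_eq_of_isUnit_det u (adjoin_range_eq_top_of_algEquiv e) z hunit) (hr (F s))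
  calc _ ≤ _ := hsrange
    _ ≤ _ := Submodule.finrank_mono hle
    _ ≤ _ := finrank_range_le_card z
    _ = n := Fintype.card_fin n

end Derivation

/-- Let `x ∈ W_n` satisfy `B_n^x = k` and let
`M_{ad x} = (ad x)^{p^n−1} − Σ_{i=0}^{n-1} φ_i(x)(ad x)^{p^i−1}`.  Then the image of `M_{ad x}`
on `W_n` equals the `k`-span of `x, x^p, ..., x^{p^{n-1}}`, which is `n`-dimensional. -/
theorem image_of_M_ad_x
    (k : Type*) [Field k] [IsAlgClosed k] (p n : ℕ) [Fact (Nat.Prime p)] [CharP k p]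
    (hp : 3 < p) (hn : 3 ≤ n)
    (B : Type*) [CommRing B] [Algebra k B] [Module.Finite k B]
    (e : (MvPolynomial (Fin n) k ⧸
        Ideal.span (Set.range fun i : Fin n =>
          (MvPolynomial.X i : MvPolynomial (Fin n) k) ^ p)) ≃ₐ[k] B)
    (φ : Fin n → Derivation k B B → k)
    (hφ : ∀ y : Derivation k B B,
      LinearMap.charpoly (y : B →ₗ[k] B) =
        X ^ (p ^ n) - ∑ i : Fin n, C (φ i y) * X ^ (p ^ (i : ℕ)))
    (x : Derivation k B B)
    (hconst : ∀ f : B, x f = 0 ↔ ∃ c : k, f = algebraMap k B c)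
    (xp : Fin n → Derivation k B B)
    (hxp : ∀ i, ((xp i : B →ₗ[k] B)) = (x : B →ₗ[k] B) ^ (p ^ (i : ℕ)))
    (M : Derivation k B B → Derivation k B B)
    (hM : ∀ y, M y = (fun z => ⁅x, z⁆)^[p ^ n - 1] y
      - ∑ i : Fin n, φ i x • (fun z => ⁅x, z⁆)^[p ^ (i : ℕ) - 1] y) :
    Set.range M = ↑(Submodule.span k (Set.range xp)) ∧
      Module.finrank k (Submodule.span k (Set.range xp)) = n := by
  have hp1 := (Fact.out : p.Prime)
  let r : Derivation k B B → k[X] := fun y =>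
    X ^ (p ^ n - 1) - ∑ i : Fin n, C (φ i y) * X ^ (p ^ (i : ℕ) - 1)
  have hr : ∀ y : Derivation k B B, X * r y = LinearMap.charpoly (y : B →ₗ[k] B) := by
    intro y
    rw [hφ, mul_sub, Finset.mul_sum, mul_pow_sub_one (pow_pos hp1.pos n).ne']
    congr 1
    refine Finset.sum_congr rfl fun i _ => ?_
    rw [mul_left_comm, mul_pow_sub_one (pow_pos hp1.pos i).ne']
  have hr0 : ∀ y : Derivation k B B, aeval (y : B →ₗ[k] B) (X * r y) = 0 := fun y => by
    rw [hr, LinearMap.aeval_self_charpoly]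
  have haeval : ∀ y w, aeval (LieAlgebra.ad k (Derivation k B B) y) (r y) w =
      (LieAlgebra.ad k (Derivation k B B) y ^ (p ^ n - 1)) w -
        ∑ i : Fin n, φ i y • (LieAlgebra.ad k (Derivation k B B) y ^ (p ^ (i : ℕ) - 1)) w := by
    intro y w
    simp [r, LinearMap.sum_apply, Module.algebraMap_end_apply]
  have hMr : M = aeval (LieAlgebra.ad k (Derivation k B B) x) (r x) := by
    funext y
    rw [hM, haeval]
    simp only [Module.End.pow_apply]
    rfl
  have hcoeff : ∀ i y, φ i y = -(LinearMap.charpoly (y : B →ₗ[k] B)).coeff (p ^ (i : ℕ)) := by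
    intro i y
    have hinj : ∀ a b : ℕ, p ^ a = p ^ b ↔ a = b := fun a b =>
      (Nat.pow_right_injective hp1.two_le).eq_iff
    rw [hφ, coeff_sub, finsetSum_coeff, coeff_X_pow, if_neg fun h => i.2.ne ((hinj _ _).1 h), zero_sub, neg_neg,
      Finset.sum_eq_single i]
    · simp
    · intro j _ hji
      rw [coeff_C_mul, coeff_X_pow, if_neg fun h => hji (Fin.ext ((hinj _ _).1 h.symm)), mul_zero]
    · simp
  have hpoly : ∀ (x y : Derivation k B B) (w : Derivation k B B),
      (fun s : k => aeval (LieAlgebra.ad k (Derivation k B B) (x + s • y)) (r (x + s • y)) w) ∈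
        polynomialFamilies k (Derivation k B B) := by
    intro x y w
    have hF : (fun s : k => x + s • y) ∈ polynomialFamilies k (Derivation k B B) :=
      Submodule.add_mem _ (const_mem_polynomialFamilies x) (smul_const_mem_polynomialFamilies y)
    have had := fun m => Derivation.ad_pow_apply_mem_polynomialFamilies hF m w
    have hφF : ∀ i, (fun s : k => φ i (x + s • y)) ∈ polynomialFamilies k k := by
      intro i
      simp_rw [hcoeff]
      exact Submodule.neg_mem _ (coeff_charpoly_mem_polynomialFamilies (x : B →ₗ[k] B) y _)
    simp_rw [haeval]
    refine Submodule.sub_mem _ (had _) ?_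
    convert Submodule.sum_mem (polynomialFamilies k (Derivation k B B)) (t := Finset.univ)
      fun (i : Fin n) _ => map₂_mem_polynomialFamilies
        (LinearMap.lsmul k (Derivation k B B)) (hφF i) (had (p ^ (i : ℕ) - 1)) using 1
    funext s
    rw [Finset.sum_apply]
    rfl
  have hx : ∀ f : B, x f = 0 → ∃ c : k, f = algebraMap k B c := fun f => (hconst f).1
  have hfin := Derivation.finite_of_finite (K := k) (B := B)
  have hli : LinearIndependent k xp := by
    refine LinearIndependent.of_comp (Derivation.toEnd k B) ?_
    convert Derivation.linearIndependent_pow_prime_pow (hφ x) hx using 1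
    exact funext hxp
  have hrank : Module.finrank k (Submodule.span k (Set.range xp)) = n := by
    rw [finrank_span_eq_card hli, Fintype.card_fin]
  have hle : Submodule.span k (Set.range xp) ≤
      LinearMap.range (aeval (LieAlgebra.ad k (Derivation k B B) x) (r x)) := by
    obtain ⟨f, hf⟩ : ∃ f, aeval (x : B →ₗ[k] B) (r x) f ≠ 0 := by
      by_contra! h
      exact Module.End.aeval_ne_zero_of_X_mul_eq_charpoly (x : B →ₗ[k] B)
        (Derivation.finrank_ker_le_one x hx) (hr x) (LinearMap.ext h)
    obtain ⟨c, hc⟩ := hx (aeval (x : B →ₗ[k] B) (r x) f) (by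
      have := LinearMap.congr_fun (hr0 x) f
      rwa [map_mul, aeval_X] at this)
    have hc0 : c ≠ 0 := by
      rintro rfl
      exact hf (by rw [hc, map_zero])
    rw [Submodule.span_le]
    rintro _ ⟨l, rfl⟩
    refine ⟨c⁻¹ • f • xp l, ?_⟩
    rw [map_smul, Derivation.aeval_ad_smul_of_lie_eq_zero x _
      (Derivation.lie_eq_zero_of_coe_eq_pow (hxp l)), hc, algebraMap_smul, smul_smul,
      inv_mul_cancel₀ hc0, one_smul]
  have : Infinite k := IsAlgClosed.instInfinite
  have heq := Submodule.eq_of_le_of_finrank_le hle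
    ((Derivation.finrank_range_aeval_ad_le e hr0 hpoly x hx).trans hrank.ge)
  exact ⟨by rw [hMr, heq, LinearMap.coe_range], hrank⟩
end

section
/- For x ∈ W_1 = Der(k[X]/(X^p)), the fiber of the adjoint quotient over 1, i.e. the solution set of x^p − x = 0 in W_1, is the union of the finitely many Aut(W_1)-orbits with representatives (1+X)d/dX and λX·d/dX for λ ∈ F_p^*. -/
open Finset Polynomial

namespace TruncatedPolynomial

variable {k B : Type*} [Field k] [CommRing B] [Algebra k B]

theorem exists_eq_aeval {p : ℕ}
    (e : (MvPolynomial (Fin 1) k ⧸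
        Ideal.span (Set.range fun i : Fin 1 =>
          (MvPolynomial.X i : MvPolynomial (Fin 1) k) ^ p)) ≃ₐ[k] B) (f : B) :
    ∃ q : k[X], f = aeval (e (Ideal.Quotient.mk _ (MvPolynomial.X 0))) q := by
  obtain ⟨a, rfl⟩ := e.surjective f
  obtain ⟨P, rfl⟩ := Ideal.Quotient.mk_surjective a
  induction P using MvPolynomial.induction_on with
  | C a => exact ⟨C a, by rw [aeval_C]; exact e.commutes a⟩
  | add P Q hP hQ =>
    obtain ⟨q, hq⟩ := hP
    obtain ⟨r, hr⟩ := hQ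
    exact ⟨q + r, by rw [map_add, map_add, map_add, hq, hr]⟩
  | mul_X P i hP =>
    obtain ⟨q, hq⟩ := hP
    refine ⟨q * X, ?_⟩
    rw [map_mul, map_mul, map_mul, hq, aeval_X, Subsingleton.elim i 0]

theorem pow_generator_eq_zero {p : ℕ}
    (e : (MvPolynomial (Fin 1) k ⧸
        Ideal.span (Set.range fun i : Fin 1 =>
          (MvPolynomial.X i : MvPolynomial (Fin 1) k) ^ p)) ≃ₐ[k] B) :
    (e (Ideal.Quotient.mk _ (MvPolynomial.X 0))) ^ p = 0 := by
  rw [← map_pow, ← map_pow, Ideal.Quotient.eq_zero_iff_mem.mpr, map_zero]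
  exact Ideal.subset_span ⟨0, rfl⟩

theorem exists_algHom_apply_generator {p : ℕ}
    (e : (MvPolynomial (Fin 1) k ⧸
        Ideal.span (Set.range fun i : Fin 1 =>
          (MvPolynomial.X i : MvPolynomial (Fin 1) k) ^ p)) ≃ₐ[k] B)
    (v : B) (hv : v ^ p = 0) :
    ∃ h : B →ₐ[k] B, h (e (Ideal.Quotient.mk _ (MvPolynomial.X 0))) = v := by
  have key : ∀ a ∈ Ideal.span (Set.range fun i : Fin 1 =>
      (MvPolynomial.X i : MvPolynomial (Fin 1) k) ^ p),
      MvPolynomial.aeval (fun _ => v) a = 0 := by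
    intro a ha
    have hle : Ideal.span (Set.range fun i : Fin 1 =>
        (MvPolynomial.X i : MvPolynomial (Fin 1) k) ^ p) ≤
        RingHom.ker (MvPolynomial.aeval (R := k) fun _ : Fin 1 => v) := by
      rw [Ideal.span_le]
      rintro _ ⟨i, rfl⟩
      simp [RingHom.mem_ker, hv]
    exact hle ha
  refine ⟨(Ideal.Quotient.liftₐ _ (MvPolynomial.aeval fun _ => v) key).comp
    (e.symm : B →ₐ[k] _), ?_⟩
  rw [AlgHom.comp_apply, AlgEquiv.coe_toAlgHom, AlgEquiv.symm_apply_apply]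
  exact (Ideal.Quotient.lift_mk _ _ _).trans (by simp)

theorem exists_eq_algebraMap_add_mul {x : B} (hgen : ∀ f : B, ∃ q : k[X], f = aeval x q) (f : B) :
    ∃ (c : k) (w : B), f = algebraMap k B c + x * w := by
  obtain ⟨q, rfl⟩ := hgen f
  refine ⟨q.coeff 0, aeval x q.divX, ?_⟩
  conv_lhs => rw [← divX_mul_X_add q]
  rw [map_add, map_mul, aeval_X, aeval_C]
  ring

theorem isUnit_or_dvd {x : B} {p : ℕ} (hxp : x ^ p = 0)
    (hgen : ∀ f : B, ∃ q : k[X], f = aeval x q) (f : B) : IsUnit f ∨ x ∣ f := by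
  obtain ⟨c, w, rfl⟩ := exists_eq_algebraMap_add_mul hgen f
  by_cases hc : c = 0
  · right
    simp [hc]
  · left
    have hn : IsNilpotent (x * w) := ⟨p, by rw [mul_pow, hxp, zero_mul]⟩
    exact hn.isUnit_add_left_of_commute ((IsUnit.mk0 c hc).map (algebraMap k B)) (Commute.all _ _)

theorem pow_ne_zero_of_lt [Nontrivial B] {p : ℕ} [CharP k p] {x : B} (D : Derivation k B B)
    (hD : D x = 1) {i : ℕ} (hi : i < p) : x ^ i ≠ 0 := by
  induction i with
  | zero => simp
  | succ i ih =>
    intro h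
    have h1 := congrArg D h
    rw [D.leibniz_pow, hD, map_zero, Nat.add_sub_cancel, smul_eq_mul, mul_one,
      ← Nat.cast_smul_eq_nsmul k] at h1
    rcases smul_eq_zero.mp h1 with h2 | h2
    · exact absurd (Nat.le_of_dvd (Nat.succ_pos i) ((CharP.cast_eq_zero_iff k p _).mp h2))
        (by omega)
    · exact ih (by omega) h2

/-- An endomorphism of `k[X]/(X^p)` sending `X` to a nilpotent element with invertible
derivative is an automorphism. -/
theorem exists_algEquiv_apply_generator [Module.Finite k B] [Nontrivial B] {p : ℕ} [CharP k p]
    {x : B} (hxp : x ^ p = 0)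
    (hgen : ∀ f : B, ∃ q : k[X], f = aeval x q)
    (hlift : ∀ v : B, v ^ p = 0 → ∃ h : B →ₐ[k] B, h x = v)
    (D : Derivation k B B) (hD : D x = 1) {v : B} (hv : x ∣ v) (hDv : IsUnit (D v)) :
    ∃ g : B ≃ₐ[k] B, g x = v := by
  have hx0 : ¬ IsUnit x := fun h => not_isUnit_zero (hxp ▸ h.pow p)
  obtain ⟨w, rfl⟩ := hv
  have hw : IsUnit w := by
    refine (isUnit_or_dvd hxp hgen w).resolve_right fun hdvd => hx0 ?_
    refine isUnit_of_dvd_unit ?_ hDv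
    rw [D.leibniz, hD, smul_eq_mul, smul_eq_mul, mul_one]
    exact dvd_add (dvd_mul_right _ _) hdvd
  obtain ⟨h, hh⟩ := hlift (x * w) (by rw [mul_pow, hxp, zero_mul])
  have hinj : Function.Injective h := by
    rw [injective_iff_map_eq_zero]
    intro f hf
    have hdvd : ∀ i ≤ p, x ^ i ∣ f := by
      intro i
      induction i with
      | zero => simp
      | succ i ih =>
        intro hi
        obtain ⟨c, rfl⟩ := ih (by omega)
        have hc : x ∣ c := by
          refine (isUnit_or_dvd hxp hgen c).resolve_left fun hc => ?_
          rw [map_mul, map_pow, hh, mul_pow, mul_assoc] at hf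
          have hu : IsUnit (w ^ i * h c) := (hw.pow i).mul (hc.map h)
          exact pow_ne_zero_of_lt D hD (by omega : i < p) (hu.mul_left_eq_zero.mp hf)
        rw [pow_succ]
        exact mul_dvd_mul_left _ hc
    simpa [hxp] using hdvd p le_rfl
  have hsurj : Function.Surjective h :=
    (LinearMap.injective_iff_surjective (f := h.toLinearMap)).mp hinj
  exact ⟨AlgEquiv.ofBijective h ⟨hinj, hsurj⟩, hh⟩

theorem derivation_eq_conj {x : B} (hgen : ∀ f : B, ∃ q : k[X], f = aeval x q)
    (y Z : Derivation k B B) (g : B ≃ₐ[k] B) (hy : y (g x) = g (Z x)) (f : B) :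
    y f = g (Z (g.symm f)) := by
  obtain ⟨f, rfl⟩ := g.surjective f
  obtain ⟨q, rfl⟩ := hgen f
  rw [AlgEquiv.symm_apply_apply, Derivation.map_aeval, smul_eq_mul, map_mul, ← hy,
    ← aeval_algHom_apply, Derivation.map_aeval, smul_eq_mul, ← aeval_algHom_apply]

theorem pow_apply_of_charpoly_eq [Module.Finite k B] {p : ℕ} {T : B →ₗ[k] B} {c : k}
    (hT : T.charpoly = X ^ p - C c * X) : T ^ p = c • T := by
  have h := T.aeval_self_charpoly
  rw [hT, map_sub, map_mul, map_pow, aeval_X, aeval_C, sub_eq_zero] at h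
  rw [h, Algebra.smul_def]

theorem pow_eq_mul_of_apply_eq_smul [Module.Finite k B] {p : ℕ} {T : B →ₗ[k] B} {c μ : k}
    (hT : T.charpoly = X ^ p - C c * X) {v : B} (hv : v ≠ 0) (hTv : T v = μ • v) :
    μ ^ p = c * μ := by
  have h1 : (T ^ p) v = μ ^ p • v :=
    Module.End.HasEigenvector.pow_apply ⟨Module.End.mem_eigenspace_iff.mpr hTv, hv⟩ p
  rw [pow_apply_of_charpoly_eq hT, LinearMap.smul_apply, hTv, smul_smul] at h1
  exact (smul_left_injective k hv h1).symm

theorem iSup_eigenspace_eq_top [IsAlgClosed k] [Module.Finite k B] {p : ℕ} [CharP k p]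
    {T : B →ₗ[k] B} (hT : T.charpoly = X ^ p - X) :
    ⨆ μ, Module.End.eigenspace T μ = ⊤ := by
  have hsep : (X ^ p - X : k[X]).Separable := galois_poly_separable p p dvd_rfl
  have hss : Module.End.IsSemisimple T :=
    Module.End.isSemisimple_of_squarefree_aeval_eq_zero hsep.squarefree
      (hT ▸ T.aeval_self_charpoly)
  rw [← Module.End.iSup_maxGenEigenspace_eq_top T]
  exact iSup_congr fun μ => (hss.isFinitelySemisimple.maxGenEigenspace_eq_eigenspace μ).symm

/-- A diagonalizable operator has an eigenvector whose derivative is invertible. -/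
theorem exists_eigenvector_isUnit_derivation {x : B} {p : ℕ}
    (hxp : x ^ p = 0) (hgen : ∀ f : B, ∃ q : k[X], f = aeval x q) [Nontrivial B]
    (D : Derivation k B B) (hD : D x = 1) {T : B →ₗ[k] B}
    (hT : ⨆ μ, Module.End.eigenspace T μ = ⊤) :
    ∃ (μ : k) (u : B), T u = μ • u ∧ IsUnit (D u) := by
  by_contra! hcon
  let N : Submodule k B := ((Ideal.span {x}).restrictScalars k).comap (D : B →ₗ[k] B)
  have hN : (⊤ : Submodule k B) ≤ N := by
    rw [← hT]
    refine iSup_le fun μ u hu => ?_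
    exact Ideal.mem_span_singleton.mpr ((isUnit_or_dvd hxp hgen (D u)).resolve_left
      (hcon μ u (Module.End.mem_eigenspace_iff.mp hu)))
  have h1 : x ∣ D x := Ideal.mem_span_singleton.mp (hN (Submodule.mem_top (x := x)))
  rw [hD] at h1
  exact not_isUnit_zero (hxp ▸ (isUnit_of_dvd_one h1).pow p)

theorem exists_natCast_eq_of_pow_eq_self {p : ℕ} [Fact p.Prime] [CharP k p] {μ : k}
    (hμ : μ ^ p = μ) : ∃ m < p, (m : k) = μ := by
  have h := (Subfield.mem_bot_iff_pow_eq_self k p).mpr hμ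
  rw [← ZMod.fieldRange_castHom_eq_bot p] at h
  obtain ⟨z, rfl⟩ := h
  refine ⟨z.val, z.val_lt, ?_⟩
  rw [← map_natCast (ZMod.castHom (dvd_refl p) k) z.val, ZMod.natCast_zmod_val]

end TruncatedPolynomial

open TruncatedPolynomial

/-- For `W_1 = Der(k[X]/(X^p))`, the fiber of the adjoint quotient over `1`, i.e. the solution
set of `t^p − t = 0` in `W_1` (the set where `φ_0 = 1`), is the union of the finitely many
`Aut(W_1)`-orbits with representatives `(1+X)d/dX` and `λX·d/dX` for `λ ∈ F_p^*`. -/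
theorem witt_algebra_fiber_over_one
    (k : Type*) [Field k] [IsAlgClosed k] (p : ℕ) [Fact (Nat.Prime p)] [CharP k p]
    (hp : 3 < p)
    (B : Type*) [CommRing B] [Algebra k B] [Module.Finite k B]
    (e : (MvPolynomial (Fin 1) k ⧸
        Ideal.span (Set.range fun i : Fin 1 =>
          (MvPolynomial.X i : MvPolynomial (Fin 1) k) ^ p)) ≃ₐ[k] B)
    (x : B) (hx : x = e (Ideal.Quotient.mk _ (MvPolynomial.X 0)))
    (D : Derivation k B B) (hD : D x = 1)
    (φ : Derivation k B B → k)
    (hφ : ∀ y : Derivation k B B,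
      LinearMap.charpoly (y : B →ₗ[k] B) = X ^ p - C (φ y) * X) :
    {y : Derivation k B B | φ y = 1} =
      {y : Derivation k B B | ∃ g : B ≃ₐ[k] B,
        (∀ f : B, y f = g (((1 + x) • D) (g.symm f))) ∨
        ∃ m : ℕ, 0 < m ∧ m < p ∧
          ∀ f : B, y f = g ((((m : B) * x) • D) (g.symm f))} := by
  have hpp : p.Prime := Fact.out
  have hxp : x ^ p = 0 := hx ▸ pow_generator_eq_zero e
  have hgen : ∀ f : B, ∃ q : k[X], f = aeval x q := hx ▸ exists_eq_aeval e
  have hlift : ∀ v : B, v ^ p = 0 → ∃ h : B →ₐ[k] B, h x = v :=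
    hx ▸ exists_algHom_apply_generator e
  have hnt : Nontrivial B := by
    by_contra hB
    have hs : Subsingleton B := not_nontrivial_iff_subsingleton.mp hB
    have h := congrArg (fun q : k[X] => q.coeff p) (hφ 0)
    have hdeg := LinearMap.charpoly_natDegree ((0 : Derivation k B B) : B →ₗ[k] B)
    rw [Module.finrank_zero_of_subsingleton] at hdeg
    simp only [coeff_sub, coeff_X_pow, coeff_C_mul, coeff_X] at h
    rw [coeff_eq_zero_of_natDegree_lt (by omega)] at h
    simp [hpp.one_lt.ne] at h
  have hxu : ¬ IsUnit x := fun h => not_isUnit_zero (hxp ▸ h.pow p)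
  ext y
  simp only [Set.mem_ofPred_eq]
  constructor
  · intro hy
    have hch : LinearMap.charpoly (y : B →ₗ[k] B) = X ^ p - X := by
      rw [hφ, hy, C_1, one_mul]
    obtain ⟨μ, u, hyu, hDu⟩ := exists_eigenvector_isUnit_derivation hxp hgen D hD
      (iSup_eigenspace_eq_top hch)
    replace hyu : y u = μ • u := hyu
    have hu0 : u ≠ 0 := by
      rintro rfl
      simp at hDu
    have hμp : μ ^ p = μ := by
      simpa [hy] using pow_eq_mul_of_apply_eq_smul (hφ y) hu0 hyu
    have hμ0 : μ ≠ 0 := by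
      rintro rfl
      have hder : ∀ (d : Derivation k B B) (f : B), d f * D u = D f * d u := by
        intro d f
        obtain ⟨q, rfl⟩ := hgen f
        obtain ⟨r, rfl⟩ := hgen u
        simp only [Derivation.map_aeval, hD, smul_eq_mul]
        ring
      have hy0 : y = 0 := by
        ext f
        have h := hder y f
        rw [hyu, zero_smul, mul_zero] at h
        exact hDu.mul_left_eq_zero.mp h
      rw [hy0, Derivation.coe_zero_linearMap, LinearMap.charpoly_zero] at hch
      simpa using congrArg (eval 1) hch
    rcases isUnit_or_dvd hxp hgen u with hu | hu
    · obtain ⟨j, -, hj⟩ := exists_natCast_eq_of_pow_eq_self (p := p)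
        (show μ⁻¹ ^ p = μ⁻¹ by rw [inv_pow, hμp])
      have hj0 : j ≠ 0 := by
        rintro rfl
        exact inv_ne_zero hμ0 (by simpa using hj.symm)
      have hyj : y (u ^ j) = u ^ j := by
        rw [y.leibniz_pow, hyu, ← Nat.cast_smul_eq_nsmul k, hj, smul_comm _ μ, smul_smul,
          inv_mul_cancel₀ hμ0, one_smul, smul_eq_mul, ← pow_succ, Nat.sub_add_cancel (by omega)]
      have hDj : IsUnit (D (u ^ j)) := by
        rw [D.leibniz_pow, ← Nat.cast_smul_eq_nsmul k, hj, Algebra.smul_def, smul_eq_mul]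
        exact ((IsUnit.mk0 _ (inv_ne_zero hμ0)).map _).mul ((hu.pow _).mul hDu)
      obtain ⟨c, w, hcw⟩ := exists_eq_algebraMap_add_mul hgen (u ^ j)
      have hc : c ≠ 0 := by
        rintro rfl
        rw [map_zero, zero_add] at hcw
        exact hxu (isUnit_of_mul_isUnit_left (hcw ▸ hu.pow j))
      have hv : c⁻¹ • u ^ j = 1 + x * (c⁻¹ • w) := by
        rw [hcw, smul_add, Algebra.smul_def, ← map_mul, inv_mul_cancel₀ hc, map_one,
          mul_smul_comm]
      have hd : ∀ d : Derivation k B B, d (x * (c⁻¹ • w)) = c⁻¹ • d (u ^ j) := by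
        intro d
        rw [← d.map_smul, hv, map_add, d.map_one_eq_zero, zero_add]
      obtain ⟨g, hg⟩ := exists_algEquiv_apply_generator hxp hgen hlift D hD
        (dvd_mul_right x (c⁻¹ • w)) (by
          rw [hd, Algebra.smul_def]
          exact ((IsUnit.mk0 _ (inv_ne_zero hc)).map _).mul hDj)
      refine ⟨g, Or.inl (derivation_eq_conj hgen y _ g ?_)⟩
      rw [hg, hd, hyj, hv, Derivation.smul_apply, hD, smul_eq_mul, mul_one, map_add, map_one, hg]
    · obtain ⟨g, hg⟩ := exists_algEquiv_apply_generator hxp hgen hlift D hD hu hDu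
      obtain ⟨m, hmp, hm⟩ := exists_natCast_eq_of_pow_eq_self (p := p) hμp
      refine ⟨g, Or.inr ⟨m, Nat.pos_of_ne_zero ?_, hmp, derivation_eq_conj hgen y _ g ?_⟩⟩
      · rintro rfl
        exact hμ0 (by simpa using hm.symm)
      · rw [Derivation.smul_apply, hD, smul_eq_mul, mul_one, map_mul, map_natCast, hg, hyu, ← hm,
          Nat.cast_smul_eq_nsmul, nsmul_eq_mul]
  · rintro ⟨g, hy | ⟨m, hm0, hmp, hy⟩⟩
    · have hv : g (1 + x) ≠ 0 := by
        rw [map_ne_zero_iff _ g.injective]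
        intro h
        exact hxu ((eq_neg_of_add_eq_zero_right h) ▸ isUnit_one.neg)
      have hyv : y (g (1 + x)) = (1 : k) • g (1 + x) := by
        simp [hy, hD]
      simpa using (pow_eq_mul_of_apply_eq_smul (hφ y) hv hyv).symm
    · have hm : (m : k) ≠ 0 := fun h =>
        absurd (Nat.le_of_dvd hm0 ((CharP.cast_eq_zero_iff k p m).mp h)) (by omega)
      have hx0 : x ≠ 0 := by
        simpa using pow_ne_zero_of_lt D hD hpp.one_lt
      have hv : g x ≠ 0 := (map_ne_zero_iff _ g.injective).mpr hx0
      have hyv : y (g x) = (m : k) • g x := by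
        simp [hy, hD, Nat.cast_smul_eq_nsmul]
      have h := pow_eq_mul_of_apply_eq_smul (hφ y) hv hyv
      rw [← frobenius_def, map_natCast] at h
      exact mul_right_cancel₀ hm (by rw [one_mul]; exact h.symm)
end
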